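/- Let X be a Borel subset of a Polish metric space. Then every nonempty weakly closed convex subset of the space of Borel probability measures 𝓜(X) has an extreme point. -/

import Mathlib

open MeasureTheory

/-- An extreme point of a set of probability measures: it is in the set, and whenever it is
a nontrivial convex combination of two members of the set, both equal it. -/
def IsExtremePt {Ω : Type*} [MeasurableSpace Ω]
    (C : Set (ProbabilityMeasure Ω)) (μ : ProbabilityMeasure Ω) : Prop :=
  μ ∈ C ∧ ∀ μ₁ ∈ C, ∀ μ₂ ∈ C, ∀ θ : ENNReal, 0 < θ → θ < 1 →
    (μ : Measure Ω) = θ • (μ₁ : Measure Ω) + (1 - θ) • (μ₂ : Measure Ω) →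
    μ₁ = μ ∧ μ₂ = μ

/-- Convexity of a set of probability measures. -/
def IsMeasConvex {Ω : Type*} [MeasurableSpace Ω]
    (C : Set (ProbabilityMeasure Ω)) : Prop :=
  ∀ μ₁ ∈ C, ∀ μ₂ ∈ C, ∀ θ : ENNReal, 0 < θ → θ < 1 →
    ∀ κ : ProbabilityMeasure Ω,
      (κ : Measure Ω) = θ • (μ₁ : Measure Ω) + (1 - θ) • (μ₂ : Measure Ω) → κ ∈ C

open Filter Topology BoundedContinuousFunction
open scoped ENNReal NNReal

/-- Weighted mass outside a sequence of sets. -/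
noncomputable def tightFun {Ω : Type*} [MeasurableSpace Ω] (K : ℕ → Set Ω) (μ : Measure Ω) :
    ℝ≥0∞ := ∑' n : ℕ, ((n : ℝ≥0∞) + 1) * μ (K n)ᶜ

lemma tightFun_comb {Ω : Type*} [MeasurableSpace Ω] (K : ℕ → Set Ω) (μ ν : Measure Ω)
    (a b : ℝ≥0∞) :
    tightFun K (a • μ + b • ν) = a * tightFun K μ + b * tightFun K ν := by
  simp only [tightFun, ← ENNReal.tsum_mul_left, ← ENNReal.tsum_add]
  refine tsum_congr fun n ↦ ?_
  simp only [Measure.add_apply, Measure.smul_apply, smul_eq_mul]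
  ring

lemma tightFun_lsc {Ω : Type*} [MeasurableSpace Ω] [TopologicalSpace Ω] [OpensMeasurableSpace Ω]
    [HasOuterApproxClosed Ω] (K : ℕ → Set Ω) (hK : ∀ n, IsClosed (K n)) :
    LowerSemicontinuous fun μ : ProbabilityMeasure Ω ↦ tightFun K (μ : Measure Ω) := by
  refine lowerSemicontinuous_tsum fun n ↦ ?_
  have h1 : LowerSemicontinuous fun μ : ProbabilityMeasure Ω ↦ (μ : Measure Ω) (K n)ᶜ := by
    rw [lowerSemicontinuous_iff_le_liminf]
    intro μ
    exact ProbabilityMeasure.le_liminf_measure_open_of_tendsto tendsto_id (hK n).isOpen_compl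
  exact (ENNReal.continuous_const_mul (a := (n : ℝ≥0∞) + 1) (by finiteness)).comp_lowerSemicontinuous
    h1 (fun x y h ↦ mul_le_mul_right h _)

lemma exists_compact_small {Y : Type*} [MetricSpace Y] [PolishSpace Y] [MeasurableSpace Y]
    [BorelSpace Y] (s : Set Y) (hs : MeasurableSet s) (μ : ProbabilityMeasure s) (ε : ℝ≥0∞)
    (hε : ε ≠ 0) : ∃ K : Set s, IsCompact K ∧ (μ : Measure s) Kᶜ < ε := by
  obtain ⟨K, hKs, hK, hlt⟩ := hs.exists_isCompact_sdiff_lt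
    (μ := (μ : Measure s).map Subtype.val) (measure_ne_top _ _) hε
  refine ⟨Subtype.val ⁻¹' K, ?_, ?_⟩
  · rw [Subtype.isCompact_iff]
    simpa [Set.inter_eq_right.2 hKs] using hK
  · rw [Measure.map_apply measurable_subtype_coe (hs.diff hK.measurableSet)] at hlt
    convert hlt using 2
    ext x
    simp

lemma exists_compact_seq {Y : Type*} [MetricSpace Y] [PolishSpace Y] [MeasurableSpace Y]
    [BorelSpace Y] (s : Set Y) (hs : MeasurableSet s) (μ : ProbabilityMeasure s) :
    ∃ K : ℕ → Set s, (∀ n, IsCompact (K n)) ∧ tightFun K (μ : Measure s) < ∞ := by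
  obtain ⟨ε, hε, hsum⟩ := ENNReal.exists_pos_sum_of_countable' (one_ne_zero (α := ℝ≥0∞)) ℕ
  have h (n : ℕ) := exists_compact_small s hs μ (ε n / ((n : ℝ≥0∞) + 1))
    (ENNReal.div_pos (hε n).ne' (by finiteness)).ne'
  choose K hK hlt using h
  refine ⟨K, hK, lt_of_le_of_lt (ENNReal.tsum_le_tsum fun n ↦ ?_) (hsum.trans ENNReal.one_lt_top)⟩
  calc ((n : ℝ≥0∞) + 1) * (μ : Measure s) (K n)ᶜ
      ≤ ((n : ℝ≥0∞) + 1) * (ε n / ((n : ℝ≥0∞) + 1)) := by gcongr; exact (hlt n).le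
    _ ≤ ε n := ENNReal.mul_div_le

lemma isCompact_tightFun_le {Ω : Type*} [MeasurableSpace Ω] [MetricSpace Ω] [BorelSpace Ω]
    (K : ℕ → Set Ω) (hK : ∀ n, IsCompact (K n)) (c : ℝ≥0∞) (hc : c ≠ ∞) :
    IsCompact {μ : ProbabilityMeasure Ω | tightFun K (μ : Measure Ω) ≤ c} := by
  have hcl : IsClosed {μ : ProbabilityMeasure Ω | tightFun K (μ : Measure Ω) ≤ c} :=
    (tightFun_lsc K fun n ↦ (hK n).isClosed).isClosed_preimage c
  have hu : Tendsto (fun n : ℕ ↦ c.toNNReal / ((n : ℝ≥0) + 1)) atTop (𝓝 0) := by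
    have := (tendsto_one_div_add_atTop_nhds_zero_nat (𝕜 := ℝ≥0)).const_mul c.toNNReal
    simpa [div_eq_mul_inv] using this
  refine (isCompact_setOfPred_probabilityMeasure_mass_eq_compl_isCompact_le hu hK
    (Or.inl inferInstance)).of_isClosed_subset hcl ?_
  intro μ hμ n
  have h1 : ((n : ℝ≥0∞) + 1) * (μ : Measure Ω) (K n)ᶜ ≤ c :=
    (ENNReal.le_tsum (f := fun n : ℕ ↦ ((n : ℝ≥0∞) + 1) * (μ : Measure Ω) (K n)ᶜ) n).trans hμ
  rw [← ProbabilityMeasure.ennreal_coeFn_eq_coeFn_toMeasure, ← ENNReal.coe_toNNReal hc] at h1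
  have h2 : ((n : ℝ≥0) + 1) * μ (K n)ᶜ ≤ c.toNNReal := by exact_mod_cast h1
  rw [le_div_iff₀ (by positivity), mul_comm]
  exact h2

lemma exists_extremePt_of_compact {Ω : Type*} [MeasurableSpace Ω] [MetricSpace Ω] [BorelSpace Ω]
    (F : Set (ProbabilityMeasure Ω)) (hF : IsCompact F) (hne : F.Nonempty) :
    ∃ μ, IsExtremePt F μ := by
  let T : ProbabilityMeasure Ω → ((Ω →ᵇ ℝ) → ℝ) := fun μ f ↦ ∫ x, f x ∂(μ : Measure Ω)
  have hT : Continuous T := continuous_pi fun f ↦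
    ProbabilityMeasure.continuous_integral_boundedContinuousFunction f
  have hinj : Function.Injective T := by
    intro μ ν h
    have h' : (μ : Measure Ω) = (ν : Measure Ω) :=
      ext_of_forall_integral_eq_of_IsFiniteMeasure fun f ↦ congrFun h f
    exact Subtype.ext h'
  obtain ⟨x, hx⟩ := (hF.image hT).extremePoints_nonempty (hne.image T)
  rw [mem_extremePoints] at hx
  obtain ⟨⟨μ, hμ, rfl⟩, hext⟩ := hx
  refine ⟨μ, hμ, fun μ₁ h₁ μ₂ h₂ θ h0 hlt heq ↦ ?_⟩
  have := hext _ ⟨μ₁, h₁, rfl⟩ _ ⟨μ₂, h₂, rfl⟩ ⟨θ.toReal, (1 - θ).toReal,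
    ENNReal.toReal_pos h0.ne' hlt.ne_top,
    ENNReal.toReal_pos (tsub_pos_of_lt hlt).ne' (by finiteness), ?_, ?_⟩
  · exact ⟨hinj this.1, hinj this.2⟩
  · rw [ENNReal.toReal_sub_of_le hlt.le (by simp)]; simp
  · funext f
    simp only [T, Pi.add_apply, Pi.smul_apply, heq]
    rw [integral_add_measure, integral_smul_measure, integral_smul_measure]
    · exact (f.integrable _).smul_measure hlt.ne_top
    · exact (f.integrable _).smul_measure (by finiteness)

theorem exists_extremePt_of_closed_convex
    {Y : Type*} [MetricSpace Y] [PolishSpace Y] [MeasurableSpace Y] [BorelSpace Y]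
    (s : Set Y) (hs : MeasurableSet s)
    (C : Set (ProbabilityMeasure s)) (hne : C.Nonempty)
    (hclosed : IsClosed C) (hconv : IsMeasConvex C) :
    ∃ μ, IsExtremePt C μ := by
  obtain ⟨μ₀, hμ₀⟩ := hne
  obtain ⟨K, hK, hfin⟩ := exists_compact_seq s hs μ₀
  have hcomp (c : ℝ≥0∞) (hc : c ≠ ∞) :
      IsCompact (C ∩ {μ : ProbabilityMeasure s | tightFun K (μ : Measure s) ≤ c}) :=
    (isCompact_tightFun_le K hK c hc).inter_left hclosed
  obtain ⟨ν, ⟨hνC, hνle⟩, hmin⟩ := LowerSemicontinuousOn.exists_isMinOn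
    (s := C ∩ {μ : ProbabilityMeasure s | tightFun K (μ : Measure s) ≤ tightFun K (μ₀ : Measure s)})
    ⟨μ₀, hμ₀, le_refl (tightFun K (μ₀ : Measure s))⟩ (hcomp _ hfin.ne)
    ((tightFun_lsc K fun n ↦ (hK n).isClosed).lowerSemicontinuousOn _)
  have hνfin : tightFun K (ν : Measure s) ≠ ∞ := (lt_of_le_of_lt hνle hfin).ne
  have hmin' : ∀ μ ∈ C, tightFun K (ν : Measure s) ≤ tightFun K (μ : Measure s) := by
    intro μ hμ
    rcases le_total (tightFun K (μ : Measure s)) (tightFun K (μ₀ : Measure s)) with h | h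
    · exact hmin ⟨hμ, h⟩
    · exact le_trans hνle h
  obtain ⟨μ, ⟨hμC, hμle⟩, hext⟩ := exists_extremePt_of_compact _ (hcomp _ hνfin)
    ⟨ν, hνC, le_refl (tightFun K (ν : Measure s))⟩
  have key : ∀ μ₁ ∈ C, ∀ μ₂ ∈ C, ∀ a b : ℝ≥0∞, a ≠ 0 → a ≠ ∞ → b ≠ ∞ → a + b = 1 →
      (μ : Measure s) = a • (μ₁ : Measure s) + b • (μ₂ : Measure s) →
      tightFun K (μ₁ : Measure s) ≤ tightFun K (ν : Measure s) := by
    intro μ₁ h₁ μ₂ h₂ a b ha ha' hb' hab heq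
    by_contra! hlt
    have hle := hμle
    simp only [Set.mem_ofPred_eq, heq, tightFun_comb] at hle
    refine absurd hle (not_le.2 ?_)
    calc tightFun K (ν : Measure s)
        = a * tightFun K (ν : Measure s) + b * tightFun K (ν : Measure s) := by
          rw [← add_mul, hab, one_mul]
      _ < a * tightFun K (μ₁ : Measure s) + b * tightFun K (μ₂ : Measure s) :=
          ENNReal.add_lt_add_of_lt_of_le (ENNReal.mul_ne_top hb' hνfin)
            ((ENNReal.mul_lt_mul_iff_right ha ha').2 hlt) (by gcongr; exact hmin' _ h₂)
  refine ⟨μ, hμC, fun μ₁ h₁ μ₂ h₂ θ h0 hlt heq ↦ ?_⟩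
  have hne' : 1 - θ ≠ 0 := (tsub_pos_of_lt hlt).ne'
  refine hext μ₁ ⟨h₁, ?_⟩ μ₂ ⟨h₂, ?_⟩ θ h0 hlt heq
  · exact key μ₁ h₁ μ₂ h₂ θ (1 - θ) h0.ne' hlt.ne_top (by finiteness)
      (add_tsub_cancel_of_le hlt.le) heq
  · exact key μ₂ h₂ μ₁ h₁ (1 - θ) θ hne' (by finiteness) hlt.ne_top
      (tsub_add_cancel_of_le hlt.le) (by rw [heq, add_comm])
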